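/- Let λ denote Lebesgue measure on ℝ^d, let f, g : ℝ^d → ℝ≥0 be measurable functions, and let T(x) = a + R(x) be a Euclidean motion of ℝ^d (a ∈ ℝ^d, R a linear isometry). Fix m ≥ 1 and nonnegative weights w_0, …, w_{m−1}. Then the weighted α-level set distance is invariant under T: Σ_{i=0}^{m-1} w_i·λ(A_i^m(f∘T^{−1}) △ A_i^m(g∘T^{−1}))/λ(A_i^m(f∘T^{−1}) ∪ A_i^m(g∘T^{−1})) = Σ_{i=0}^{m-1} w_i·λ(A_i^m(f) △ A_i^m(g))/λ(A_i^m(f) ∪ A_i^m(g)), with the convention 0/0 = 0, where f∘T^{−1} and g∘T^{−1} are the densities of the pushforwards of λ.withDensity f and λ.withDensity g under T. -/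

import Mathlib

open MeasureTheory Set

/-- The `i`-th α-level set of `f` at resolution `m`:
`A_i^m(f) = {x : i/m ≤ f x < (i+1)/m}`. -/
def alphaLevelSet {d : ℕ} (f : EuclideanSpace ℝ (Fin d) → ℝ) (m i : ℕ) :
    Set (EuclideanSpace ℝ (Fin d)) :=
  {x | (i : ℝ) / m ≤ f x ∧ f x < ((i : ℝ) + 1) / m}

theorem measurePreserving_rigid_motion_symm {d : ℕ} (a : EuclideanSpace ℝ (Fin d))
    (R : EuclideanSpace ℝ (Fin d) ≃ₗᵢ[ℝ] EuclideanSpace ℝ (Fin d)) :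
    MeasurePreserving (fun y => R.symm (y - a)) :=
  R.symm.measurePreserving.comp (measurePreserving_sub_right volume a)

theorem measurableSet_alphaLevelSet {d : ℕ} {f : EuclideanSpace ℝ (Fin d) → ℝ}
    (hf : Measurable f) (m i : ℕ) : MeasurableSet (alphaLevelSet f m i) :=
  (measurableSet_le measurable_const hf).inter (measurableSet_lt hf measurable_const)

theorem alphaLevelSet_comp {d : ℕ} (f : EuclideanSpace ℝ (Fin d) → ℝ)
    (S : EuclideanSpace ℝ (Fin d) → EuclideanSpace ℝ (Fin d)) (m i : ℕ) :
    alphaLevelSet (fun y => f (S y)) m i = S ⁻¹' alphaLevelSet f m i :=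
  rfl

/-- Invariance of the weighted α-level set distance under a Euclidean motion
`T(x) = a + R(x)`: the distance computed from the transported densities
`f∘T⁻¹, g∘T⁻¹` equals the distance computed from `f, g` (convention `0/0 = 0`,
as holds for real division). -/
theorem alphaLevelSet_distance_invariant_rigid_motion {d : ℕ}
    (f g : EuclideanSpace ℝ (Fin d) → ℝ)
    (hf0 : ∀ x, 0 ≤ f x) (hfm : Measurable f)
    (hg0 : ∀ x, 0 ≤ g x) (hgm : Measurable g)
    (a : EuclideanSpace ℝ (Fin d))
    (R : EuclideanSpace ℝ (Fin d) ≃ₗᵢ[ℝ] EuclideanSpace ℝ (Fin d))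
    (T : EuclideanSpace ℝ (Fin d) → EuclideanSpace ℝ (Fin d))
    (hT : ∀ x, T x = a + R x)
    (fT gT : EuclideanSpace ℝ (Fin d) → ℝ)
    (hfT : ∀ y, fT y = f (R.symm (y - a)))
    (hgT : ∀ y, gT y = g (R.symm (y - a)))
    (m : ℕ) (hm : 1 ≤ m) (w : ℕ → ℝ) (hw : ∀ i, 0 ≤ w i) :
    (∑ i ∈ Finset.range m, w i *
        (volume (symmDiff (alphaLevelSet fT m i) (alphaLevelSet gT m i))).toReal /
        (volume (alphaLevelSet fT m i ∪ alphaLevelSet gT m i)).toReal) =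
    (∑ i ∈ Finset.range m, w i *
        (volume (symmDiff (alphaLevelSet f m i) (alphaLevelSet g m i))).toReal /
        (volume (alphaLevelSet f m i ∪ alphaLevelSet g m i)).toReal) := by
  obtain rfl : fT = fun y => f (R.symm (y - a)) := funext hfT
  obtain rfl : gT = fun y => g (R.symm (y - a)) := funext hgT
  have hS := measurePreserving_rigid_motion_symm a R
  refine Finset.sum_congr rfl fun i _ => ?_
  have hA := measurableSet_alphaLevelSet hfm m i
  have hB := measurableSet_alphaLevelSet hgm m i
  rw [alphaLevelSet_comp f (fun y => R.symm (y - a)),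
    alphaLevelSet_comp g (fun y => R.symm (y - a)), ← preimage_symmDiff, ← preimage_union,
    hS.measure_preimage (hA.symmDiff hB).nullMeasurableSet,
    hS.measure_preimage (hA.union hB).nullMeasurableSet]
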